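/- Let (A,+,·) be a left brace with A^{(3)} = {0} and let a ∈ A. For i ∈ ℤ set a_i = λ_{a^i}(a), where a^i is the i-th power of a in the group (A,·). Let B be the additive subgroup of A generated by {a_i : i ∈ ℤ}. Then B is closed under the product · and under multiplicative inverses (hence B is a subbrace of A), B contains a, and B is contained in every subbrace of A containing a; that is, B is the subbrace of A generated by a. Furthermore, the additive subgroup generated by {x*y : x,y ∈ B} equals the additive subgroup generated by {a_i − a : i ∈ ℤ}. -/

import Mathlib

/-- `λ_a(b) = -a + a·b` for a left-brace multiplication `mul`. -/
def braceLam {A : Type*} [AddCommGroup A] (mul : A → A → A) (a b : A) : A :=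
  -a + mul a b

/-- The star operation `a * b = λ_a(b) - b`. -/
def braceStar {A : Type*} [AddCommGroup A] (mul : A → A → A) (a b : A) : A :=
  braceLam mul a b - b

/-- `rightSeries mul r` is `A^{(r+1)}` of the paper: `rightSeries mul 0 = A^{(1)} = A` and
`rightSeries mul (r+1) = A^{(r+2)} = A^{(r+1)} * A`, the additive subgroup generated by
star products of elements of `A^{(r+1)}` with elements of `A`. -/
def rightSeries {A : Type*} [AddCommGroup A] (mul : A → A → A) : ℕ → AddSubgroup A
  | 0 => ⊤
  | r + 1 => AddSubgroup.closure {x | ∃ z c, z ∈ rightSeries mul r ∧ x = braceStar mul z c}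

section Brace

variable {A : Type*} [AddCommGroup A] {mul : A → A → A}

theorem braceLam_add (hdist : ∀ a b c : A, mul a (b + c) = mul a b - a + mul a c) (x y z : A) :
    braceLam mul x (y + z) = braceLam mul x y + braceLam mul x z := by
  simp only [braceLam, hdist]; abel

theorem braceLam_zero_right (hzr : ∀ a : A, mul a 0 = a) (x : A) : braceLam mul x 0 = 0 := by
  simp [braceLam, hzr]

theorem braceLam_zero_left (hzl : ∀ a : A, mul 0 a = a) (x : A) : braceLam mul 0 x = x := by
  simp [braceLam, hzl]

theorem braceLam_neg (hzr : ∀ a : A, mul a 0 = a)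
    (hdist : ∀ a b c : A, mul a (b + c) = mul a b - a + mul a c) (x y : A) :
    braceLam mul x (-y) = -braceLam mul x y := by
  refine eq_neg_of_add_eq_zero_left ?_
  rw [← braceLam_add hdist, neg_add_cancel, braceLam_zero_right hzr]

theorem mul_eq_add_braceLam (x y : A) : mul x y = x + braceLam mul x y := by
  simp [braceLam]

theorem braceLam_mul (hassoc : ∀ a b c : A, mul (mul a b) c = mul a (mul b c))
    (hdist : ∀ a b c : A, mul a (b + c) = mul a b - a + mul a c) (x y z : A) :
    braceLam mul (mul x y) z = braceLam mul x (braceLam mul y z) := by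
  have h := hdist x y (braceLam mul y z)
  rw [← mul_eq_add_braceLam, ← hassoc] at h
  rw [braceLam, h, braceLam.eq_1 mul x]
  abel

/-- If `A^{(3)} = 0`, then every `x * y` acts trivially. -/
theorem braceLam_braceStar (h3 : rightSeries mul 2 = ⊥) (x y c : A) :
    braceLam mul (braceStar mul x y) c = c := by
  have h2 : braceStar mul x y ∈ rightSeries mul 1 :=
    AddSubgroup.subset_closure ⟨x, y, AddSubgroup.mem_top x, rfl⟩
  have h : braceStar mul (braceStar mul x y) c ∈ rightSeries mul 2 :=
    AddSubgroup.subset_closure ⟨_, c, h2, rfl⟩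
  rw [h3, AddSubgroup.mem_bot] at h
  exact sub_eq_zero.mp h

theorem braceLam_braceStar_add (hassoc : ∀ a b c : A, mul (mul a b) c = mul a (mul b c))
    (hdist : ∀ a b c : A, mul a (b + c) = mul a b - a + mul a c)
    (h3 : rightSeries mul 2 = ⊥) (x y z c : A) :
    braceLam mul (braceStar mul x y + z) c = braceLam mul z c := by
  have h : mul (braceStar mul x y) z = braceStar mul x y + z := by
    rw [mul_eq_add_braceLam (mul := mul), braceLam_braceStar h3]
  rw [← h, braceLam_mul hassoc hdist, braceLam_braceStar h3]

/-- If `A^{(3)} = 0`, then `λ` is also a homomorphism on the additive group. -/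
theorem braceLam_add_left (hassoc : ∀ a b c : A, mul (mul a b) c = mul a (mul b c))
    (hdist : ∀ a b c : A, mul a (b + c) = mul a b - a + mul a c)
    (h3 : rightSeries mul 2 = ⊥) (x y c : A) :
    braceLam mul (x + y) c = braceLam mul x (braceLam mul y c) := by
  rw [← braceLam_mul hassoc hdist, ← braceLam_braceStar_add hassoc hdist h3 x y (x + y)]
  congr 1
  simp only [braceStar, braceLam]
  abel

theorem power_mem (hassoc : ∀ a b c : A, mul (mul a b) c = mul a (mul b c))
    (hzl : ∀ a : A, mul 0 a = a) (hinv : ∀ a : A, ∃ b : A, mul a b = 0 ∧ mul b a = 0)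
    {a : A} {p : ℤ → A} (hp0 : p 0 = 0) (hp : ∀ i : ℤ, p (i + 1) = mul a (p i))
    {S : AddSubgroup A} (hmul : ∀ x ∈ S, ∀ y ∈ S, mul x y ∈ S)
    (hS : ∀ x ∈ S, ∀ y : A, mul x y = 0 → mul y x = 0 → y ∈ S) (ha : a ∈ S) (i : ℤ) :
    p i ∈ S := by
  induction i using Int.induction_on with
  | zero => rw [hp0]; exact S.zero_mem
  | succ i ih => rw [hp]; exact hmul _ ha _ ih
  | pred i ih =>
    obtain ⟨b, hab, hba⟩ := hinv a
    have h := hp (-(i : ℤ) - 1)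
    rw [sub_add_cancel] at h
    have hb : p (-(i : ℤ) - 1) = mul b (p (-(i : ℤ))) := by rw [h, ← hassoc, hba, hzl]
    rw [hb]
    exact hmul _ (hS a ha b hab hba) _ ih

end Brace

/-- Theorem B, Rump: Let `A` be a left brace with `A^{(3)} = {0}`, `a ∈ A`,
and for `i ∈ ℤ` let `a_i = λ_{a^i}(a)` (where `p : ℤ → A`, `p i = a^i`, is the power map of
`a` in `(A,·)`).  Let `B` be the additive subgroup generated by `{a_i : i ∈ ℤ}`.  Then `B`
is closed under `·` and under multiplicative inverses, `a ∈ B`, `B` is contained in every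
subbrace containing `a` (so `B` is the subbrace generated by `a`), and
`B * B` equals the additive subgroup generated by `{a_i - a : i ∈ ℤ}`. -/
theorem stmt7 {A : Type*} [AddCommGroup A]
    (mul : A → A → A)
    (hassoc : ∀ a b c : A, mul (mul a b) c = mul a (mul b c))
    (hzl : ∀ a : A, mul 0 a = a)
    (hzr : ∀ a : A, mul a 0 = a)
    (hinv : ∀ a : A, ∃ b : A, mul a b = 0 ∧ mul b a = 0)
    (hdist : ∀ a b c : A, mul a (b + c) = mul a b - a + mul a c)
    (h3 : rightSeries mul 2 = ⊥)
    (a : A) (p : ℤ → A) (hp0 : p 0 = 0) (hp : ∀ i : ℤ, p (i + 1) = mul a (p i))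
    (B : AddSubgroup A)
    (hB : B = AddSubgroup.closure (Set.range fun i : ℤ => braceLam mul (p i) a)) :
    (∀ x ∈ B, ∀ y ∈ B, mul x y ∈ B) ∧
    (∀ x ∈ B, ∀ y : A, mul x y = 0 → mul y x = 0 → y ∈ B) ∧
    a ∈ B ∧
    (∀ S : AddSubgroup A, (∀ x ∈ S, ∀ y ∈ S, mul x y ∈ S) →
      (∀ x ∈ S, ∀ y : A, mul x y = 0 → mul y x = 0 → y ∈ S) → a ∈ S → B ≤ S) ∧
    AddSubgroup.closure {x | ∃ u ∈ B, ∃ v ∈ B, x = braceStar mul u v} =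
      AddSubgroup.closure (Set.range fun i : ℤ => braceLam mul (p i) a - a) := by
  set c : ℤ → A := fun i => braceLam mul (p i) a with hc
  have hc0 : c 0 = a := by simp only [hc, hp0, braceLam_zero_left hzl]
  have hcB : ∀ i, c i ∈ B := fun i => hB ▸ AddSubgroup.subset_closure ⟨i, rfl⟩
  have hshift : ∀ u ∈ B, ∃ k : ℤ, ∀ i, braceLam mul u (c i) = c (i + k) := by
    intro u hu
    rw [hB] at hu
    induction hu using AddSubgroup.closure_induction with
    | mem x hx =>
      obtain ⟨j, rfl⟩ := hx
      refine ⟨1, fun i => ?_⟩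
      have hj : c j = braceStar mul (p j) a + a := by simp [hc, braceStar]
      change braceLam mul (c j) (c i) = _
      rw [hj, braceLam_braceStar_add hassoc hdist h3]
      simp only [hc, hp, braceLam_mul hassoc hdist]
    | zero => exact ⟨0, fun i => by rw [braceLam_zero_left hzl, add_zero]⟩
    | add x y _ _ hx hy =>
      obtain ⟨k, hk⟩ := hx
      obtain ⟨l, hl⟩ := hy
      exact ⟨l + k, fun i => by
        rw [braceLam_add_left hassoc hdist h3, hl, hk, add_assoc]⟩
    | neg x _ hx =>
      obtain ⟨k, hk⟩ := hx
      refine ⟨-k, fun i => ?_⟩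
      have h := hk (i + -k)
      rw [neg_add_cancel_right] at h
      rw [← h, ← braceLam_add_left hassoc hdist h3, neg_add_cancel, braceLam_zero_left hzl]
  have hlam : ∀ u ∈ B, ∀ v ∈ B, braceLam mul u v ∈ B := by
    intro u hu v hv
    obtain ⟨k, hk⟩ := hshift u hu
    rw [hB] at hv
    induction hv using AddSubgroup.closure_induction with
    | mem x hx =>
      obtain ⟨j, rfl⟩ := hx
      exact (hk j).symm ▸ hcB _
    | zero => rw [braceLam_zero_right hzr]; exact B.zero_mem
    | add x y _ _ hx hy => rw [braceLam_add hdist]; exact B.add_mem hx hy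
    | neg x _ hx => rw [braceLam_neg hzr hdist]; exact B.neg_mem hx
  have hmul : ∀ x ∈ B, ∀ y ∈ B, mul x y ∈ B := fun x hx y hy => by
    rw [mul_eq_add_braceLam (mul := mul)]
    exact B.add_mem hx (hlam x hx y hy)
  have hinvB : ∀ x ∈ B, ∀ y : A, mul x y = 0 → mul y x = 0 → y ∈ B := by
    intro x hx y hxy _
    rw [mul_eq_add_braceLam (mul := mul)] at hxy
    have h : y = braceLam mul (-x) (-x) := by
      have hneg : braceLam mul x y = -x := eq_neg_of_add_eq_zero_right hxy
      calc y = braceLam mul (-x + x) y := by rw [neg_add_cancel, braceLam_zero_left hzl]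
        _ = braceLam mul (-x) (-x) := by rw [braceLam_add_left hassoc hdist h3, hneg]
    rw [h]
    exact hlam _ (B.neg_mem hx) _ (B.neg_mem hx)
  have haB : a ∈ B := hc0 ▸ hcB 0
  refine ⟨hmul, hinvB, haB, ?_, le_antisymm ?_ ?_⟩
  · intro S hSmul hSinv haS
    rw [hB, AddSubgroup.closure_le]
    rintro _ ⟨i, rfl⟩
    have hpi := power_mem hassoc hzl hinv hp0 hp hSmul hSinv haS i
    exact S.add_mem (S.neg_mem hpi) (hSmul _ hpi _ haS)
  · rw [AddSubgroup.closure_le]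
    rintro _ ⟨u, hu, v, hv, rfl⟩
    obtain ⟨k, hk⟩ := hshift u hu
    have hca : ∀ i, c i - a ∈ AddSubgroup.closure (Set.range fun i : ℤ => c i - a) :=
      fun i => AddSubgroup.subset_closure ⟨i, rfl⟩
    change braceLam mul u v - v ∈ AddSubgroup.closure (Set.range fun i : ℤ => c i - a)
    rw [hB] at hv
    induction hv using AddSubgroup.closure_induction with
    | mem x hx =>
      obtain ⟨j, rfl⟩ := hx
      rw [hk, ← sub_sub_sub_cancel_right _ _ a]
      exact AddSubgroup.sub_mem _ (hca _) (hca _)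
    | zero => rw [braceLam_zero_right hzr, sub_zero]; exact AddSubgroup.zero_mem _
    | add x y _ _ hx hy =>
      rw [braceLam_add hdist, add_sub_add_comm]
      exact AddSubgroup.add_mem _ hx hy
    | neg x _ hx =>
      rw [braceLam_neg hzr hdist, neg_sub_neg, ← neg_sub]
      exact AddSubgroup.neg_mem _ hx
  · rw [AddSubgroup.closure_le]
    rintro _ ⟨i, rfl⟩
    exact AddSubgroup.subset_closure
      ⟨p i, power_mem hassoc hzl hinv hp0 hp hmul hinvB haB i, a, haB, rfl⟩
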